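/- For all v, w ∈ V: b_K(v, T_K(v−w)) − b_K(w, T_K(v−w)) ≥ ((1+L)/(1+2L))·(m_a/M_a)·d_{K,α}(v,w)·‖v−w‖ ≥ (1/κ)·(m_a/M_a)·d_{K,α}(v,w)·‖T_K(v−w)‖; and for all v, w, φ ∈ V: |b_K(v,φ) − b_K(w,φ)| ≤ d_{K,α}(v,w)·‖φ‖. -/

import Mathlib

open scoped RealInnerProductSpace
open Filter Topology

noncomputable section Setup

variable {V₁ V₂ Q W : Type*}
  [NormedAddCommGroup V₁] [InnerProductSpace ℝ V₁]
  [NormedAddCommGroup V₂] [InnerProductSpace ℝ V₂]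
  [NormedAddCommGroup Q] [InnerProductSpace ℝ Q]
  [NormedAddCommGroup W] [InnerProductSpace ℝ W]

/-- The ℓ²-norm on the product space `V = V₁ × V₂`. -/
def nV (v : V₁ × V₂) : ℝ := Real.sqrt (‖v.1‖ ^ 2 + ‖v.2‖ ^ 2)

/-- The seminorm `|v| = (‖I v₁‖² + ‖C* v₂‖²)^{1/2}`. -/
def sV (Cs : V₂ →L[ℝ] Q) (Iop : V₁ →L[ℝ] W) (v : V₁ × V₂) : ℝ :=
  Real.sqrt (‖Iop v.1‖ ^ 2 + ‖Cs v.2‖ ^ 2)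

/-- The vectorized bilinear form `a(v,φ) = a(v₁,φ₂) + a(φ₁,v₂)` on `V × V`. -/
def aV (a : V₁ →L[ℝ] V₂ →L[ℝ] ℝ) (v φ : V₁ × V₂) : ℝ := a v.1 φ.2 + a φ.1 v.2

/-- The bilinear form `b = a + α^{-1/2} c` of the rescaled reduced optimality system. -/
def bV (a : V₁ →L[ℝ] V₂ →L[ℝ] ℝ) (Cs : V₂ →L[ℝ] Q) (Iop : V₁ →L[ℝ] W) (α : ℝ)
    (v φ : V₁ × V₂) : ℝ :=
  aV a v φ + (Real.sqrt α)⁻¹ * (⟪Cs v.2, Cs φ.2⟫ - ⟪Iop v.1, Iop φ.1⟫)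

/-- Continuity constant `M_a = sup { a(v₁,v₂) : ‖v₁‖ = 1, ‖v₂‖ = 1 }`. -/
def contConst (a : V₁ →L[ℝ] V₂ →L[ℝ] ℝ) : ℝ :=
  sSup {r : ℝ | ∃ v₁ : V₁, ∃ v₂ : V₂, ‖v₁‖ = 1 ∧ ‖v₂‖ = 1 ∧ r = a v₁ v₂}

/-- Inf-sup constant `m_a = inf_{‖v₂‖=1} sup_{‖v₁‖=1} a(v₁,v₂)`. -/
def infSupConst (a : V₁ →L[ℝ] V₂ →L[ℝ] ℝ) : ℝ :=
  sInf {r : ℝ | ∃ v₂ : V₂, ‖v₂‖ = 1 ∧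
    r = sSup {s : ℝ | ∃ v₁ : V₁, ‖v₁‖ = 1 ∧ s = a v₁ v₂}}

/-- Discrete inf-sup constant of `a` on `V_{h,1} × V_{h,2}`. -/
def discInfSup (a : V₁ →L[ℝ] V₂ →L[ℝ] ℝ) (Vh1 : Submodule ℝ V₁)
    (Vh2 : Submodule ℝ V₂) : ℝ :=
  sInf {r : ℝ | ∃ v₁ ∈ Vh1, ‖v₁‖ = 1 ∧
    r = sSup {s : ℝ | ∃ φ₂ ∈ Vh2, ‖φ₂‖ = 1 ∧ s = a v₁ φ₂}}

/-- Best approximation error `inf_{v_h ∈ V_h} ‖x - v_h‖` in the product norm. -/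
def bestErr (Vh1 : Submodule ℝ V₁) (Vh2 : Submodule ℝ V₂) (x : V₁ × V₂) : ℝ :=
  sInf {r : ℝ | ∃ vh : V₁ × V₂, vh.1 ∈ Vh1 ∧ vh.2 ∈ Vh2 ∧ r = nV (x - vh)}

/-- The quasi-best-approximation constant `ν_h` of the Galerkin discretization of `b`:
`sup` over nonzero discrete test functions of the ratio of the continuous sup to the
discrete sup. -/
def nuConst (a : V₁ →L[ℝ] V₂ →L[ℝ] ℝ) (Cs : V₂ →L[ℝ] Q) (Iop : V₁ →L[ℝ] W) (α : ℝ)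
    (Vh1 : Submodule ℝ V₁) (Vh2 : Submodule ℝ V₂) : ℝ :=
  sSup {r : ℝ | ∃ φh : V₁ × V₂, φh.1 ∈ Vh1 ∧ φh.2 ∈ Vh2 ∧ φh ≠ 0 ∧
    r = sSup {s : ℝ | ∃ v : V₁ × V₂, nV v = 1 ∧ s = bV a Cs Iop α v φh} /
        sSup {s : ℝ | ∃ vh : V₁ × V₂, vh.1 ∈ Vh1 ∧ vh.2 ∈ Vh2 ∧ nV vh = 1 ∧
          s = bV a Cs Iop α vh φh}}

/-- The nonlinear form `c_{K,α}` associated with the control constraint set `K`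
(through its metric projection `PK`). -/
def cK (Cs : V₂ →L[ℝ] Q) (Iop : V₁ →L[ℝ] W) (PK : Q → Q) (α : ℝ) (v φ : V₁ × V₂) : ℝ :=
  -⟪PK ((-(Real.sqrt α)⁻¹) • (Cs v.2)), Cs φ.2⟫ - (Real.sqrt α)⁻¹ * ⟪Iop v.1, Iop φ.1⟫

/-- The nonlinear form `b_K = a + c_{K,α}`. -/
def bK (a : V₁ →L[ℝ] V₂ →L[ℝ] ℝ) (Cs : V₂ →L[ℝ] Q) (Iop : V₁ →L[ℝ] W) (PK : Q → Q)
    (α : ℝ) (v φ : V₁ × V₂) : ℝ :=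
  aV a v φ + cK Cs Iop PK α v φ

/-- The pseudometric `δ_{K,α}`. -/
def deltaK (Cs : V₂ →L[ℝ] Q) (Iop : V₁ →L[ℝ] W) (PK : Q → Q) (α : ℝ)
    (v w : V₁ × V₂) : ℝ :=
  Real.sqrt (α * ‖PK ((-(Real.sqrt α)⁻¹) • (Cs v.2)) -
      PK ((-(Real.sqrt α)⁻¹) • (Cs w.2))‖ ^ 2 + ‖Iop (v.1 - w.1)‖ ^ 2)

end Setup

lemma mul_add_mul_le_sqrt_mul_sqrt (x₁ x₂ y₁ y₂ : ℝ) :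
    x₁ * y₁ + x₂ * y₂ ≤ Real.sqrt (x₁ ^ 2 + x₂ ^ 2) * Real.sqrt (y₁ ^ 2 + y₂ ^ 2) := by
  rw [← Real.sqrt_mul (by positivity)]
  apply Real.le_sqrt_of_sq_le
  nlinarith [sq_nonneg (x₁ * y₂ - x₂ * y₁)]

lemma nV_nonneg {V₁ V₂ : Type*} [NormedAddCommGroup V₁] [NormedAddCommGroup V₂] (v : V₁ × V₂) :
    0 ≤ nV v := Real.sqrt_nonneg _

lemma nV_sq {V₁ V₂ : Type*} [NormedAddCommGroup V₁] [NormedAddCommGroup V₂] (v : V₁ × V₂) :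
    nV v ^ 2 = ‖v.1‖ ^ 2 + ‖v.2‖ ^ 2 :=
  Real.sq_sqrt (by positivity)

section Helpers

variable {V₁ V₂ Q W : Type*}
  [NormedAddCommGroup V₁] [InnerProductSpace ℝ V₁]
  [NormedAddCommGroup V₂] [InnerProductSpace ℝ V₂]
  [NormedAddCommGroup Q] [InnerProductSpace ℝ Q]
  [NormedAddCommGroup W] [InnerProductSpace ℝ W]

/-- A metric projection onto a convex set is firmly nonexpansive. -/
lemma norm_sub_sq_le_inner_of_metricProjection {K : Set Q} (hK : Convex ℝ K) {P : Q → Q}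
    (hmem : ∀ q, P q ∈ K) (hmin : ∀ q, ∀ p ∈ K, ‖q - P q‖ ≤ ‖q - p‖) (x y : Q) :
    ‖P x - P y‖ ^ 2 ≤ ⟪P x - P y, x - y⟫ := by
  have variational (q p : Q) (hp : p ∈ K) : ⟪q - P q, p - P q⟫ ≤ 0 := by
    have : Nonempty K := ⟨⟨P q, hmem q⟩⟩
    refine (norm_eq_iInf_iff_real_inner_le_zero hK (hmem q)).1 (le_antisymm ?_ ?_) p hp
    · exact le_ciInf fun r => hmin q r r.2
    · exact ciInf_le (f := fun r : K => ‖q - r‖)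
        ⟨0, by rintro _ ⟨r, rfl⟩; positivity⟩ ⟨P q, hmem q⟩
  have hx := variational x (P y) (hmem y)
  have hy := variational y (P x) (hmem x)
  rw [← real_inner_self_eq_norm_sq]
  simp only [inner_sub_left, inner_sub_right] at hx hy ⊢
  linarith [real_inner_comm x (P x), real_inner_comm x (P y), real_inner_comm y (P x),
    real_inner_comm y (P y), real_inner_comm (P x) (P y)]

lemma apply_le_contConst (a : V₁ →L[ℝ] V₂ →L[ℝ] ℝ) {x : V₁} {y : V₂} (hx : ‖x‖ = 1)
    (hy : ‖y‖ = 1) : a x y ≤ contConst a := by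
  refine le_csSup ⟨‖a‖, ?_⟩ ⟨x, y, hx, hy, rfl⟩
  rintro _ ⟨u, v, hu, hv, rfl⟩
  simpa [hu, hv] using (le_abs_self _).trans (a.le_opNorm₂ u v)

lemma abs_apply_le_contConst (a : V₁ →L[ℝ] V₂ →L[ℝ] ℝ) (x : V₁) (y : V₂) :
    |a x y| ≤ contConst a * (‖x‖ * ‖y‖) := by
  have upper (x : V₁) (y : V₂) : a x y ≤ contConst a * (‖x‖ * ‖y‖) := by
    rcases eq_or_ne x 0 with rfl | hx
    · simp
    rcases eq_or_ne y 0 with rfl | hy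
    · simp
    have h := apply_le_contConst a (norm_smul_inv_norm (𝕜 := ℝ) hx)
      (norm_smul_inv_norm (𝕜 := ℝ) hy)
    have hx' := norm_pos_iff.2 hx
    have hy' := norm_pos_iff.2 hy
    simp only [map_smul, smul_apply, smul_eq_mul, RCLike.ofReal_real_eq_id,
      id_eq] at h
    calc a x y = ‖y‖⁻¹ * (‖x‖⁻¹ * a x y) * (‖x‖ * ‖y‖) := by field_simp
      _ ≤ _ := by gcongr
  exact abs_le.2 ⟨by have := upper (-x) y; simp at this; linarith, upper x y⟩

lemma infSupConst_mul_norm_le [Nontrivial V₁] (a : V₁ →L[ℝ] V₂ →L[ℝ] ℝ) {y : V₂} {c : ℝ}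
    (hc : 0 ≤ c) (h : ∀ x, a x y ≤ c * ‖x‖) : infSupConst a * ‖y‖ ≤ c := by
  rcases eq_or_ne y 0 with rfl | hy
  · simpa
  have hy' := norm_pos_iff.2 hy
  obtain ⟨u, hu⟩ := exists_norm_eq V₁ zero_le_one
  rw [← le_div_iff₀ hy']
  have normalized : infSupConst a ≤
      sSup {s : ℝ | ∃ v₁ : V₁, ‖v₁‖ = 1 ∧ s = a v₁ (‖y‖⁻¹ • y)} := by
    refine csInf_le ⟨0, ?_⟩ ⟨‖y‖⁻¹ • y, norm_smul_inv_norm (𝕜 := ℝ) hy, rfl⟩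
    rintro _ ⟨z, hz, rfl⟩
    have bdd : BddAbove {s : ℝ | ∃ v₁ : V₁, ‖v₁‖ = 1 ∧ s = a v₁ z} :=
      ⟨contConst a, by rintro _ ⟨x, hx, rfl⟩; exact apply_le_contConst a hx hz⟩
    have h₁ := le_csSup bdd ⟨u, hu, rfl⟩
    have h₂ := le_csSup bdd ⟨-u, by simpa using hu, rfl⟩
    simp only [map_neg, neg_apply] at h₂
    linarith
  refine normalized.trans (csSup_le ⟨_, u, hu, rfl⟩ ?_)
  rintro _ ⟨x, hx, rfl⟩
  have hxy := h x
  rw [hx, mul_one] at hxy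
  rw [map_smul, smul_eq_mul, div_eq_inv_mul]
  gcongr

lemma infSupConst_le_contConst [Nontrivial V₁] [Nontrivial V₂] (a : V₁ →L[ℝ] V₂ →L[ℝ] ℝ) :
    infSupConst a ≤ contConst a := by
  obtain ⟨u, hu⟩ := exists_norm_eq V₁ zero_le_one
  obtain ⟨y, hy⟩ := exists_norm_eq V₂ zero_le_one
  have bound (x : V₁) : |a x y| ≤ contConst a * ‖x‖ := by
    simpa [hy] using abs_apply_le_contConst a x y
  have hc : 0 ≤ contConst a := by
    simpa [hu] using (abs_nonneg _).trans (bound u)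
  simpa [hy] using infSupConst_mul_norm_le a hc fun x => (le_abs_self _).trans (bound x)

lemma abs_aV_le (a : V₁ →L[ℝ] V₂ →L[ℝ] ℝ) (hc : 0 ≤ contConst a) (v φ : V₁ × V₂) :
    |aV a v φ| ≤ contConst a * nV v * nV φ := by
  have h₁ := abs_apply_le_contConst a v.1 φ.2
  have h₂ := abs_apply_le_contConst a φ.1 v.2
  have h₃ := mul_add_mul_le_sqrt_mul_sqrt ‖v.1‖ ‖v.2‖ ‖φ.2‖ ‖φ.1‖
  rw [add_comm (‖φ.2‖ ^ 2)] at h₃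
  calc |aV a v φ| ≤ |a v.1 φ.2| + |a φ.1 v.2| := abs_add_le _ _
    _ ≤ contConst a * (‖v.1‖ * ‖φ.2‖ + ‖v.2‖ * ‖φ.1‖) := by linarith
    _ ≤ contConst a * (nV v * nV φ) := mul_le_mul_of_nonneg_left h₃ hc
    _ = _ := by ring

lemma aV_sub_left (a : V₁ →L[ℝ] V₂ →L[ℝ] ℝ) (v w φ : V₁ × V₂) :
    aV a (v - w) φ = aV a v φ - aV a w φ := by
  simp [aV]
  ring

lemma abs_cK_sub_le (Cs : V₂ →L[ℝ] Q) (Iop : V₁ →L[ℝ] W) (PK : Q → Q) {α M : ℝ} (hα : 0 < α)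
    (hC : ‖Cs‖ ≤ M) (hI : ‖Iop‖ ≤ M) (v w φ : V₁ × V₂) :
    |cK Cs Iop PK α v φ - cK Cs Iop PK α w φ| ≤
      M / Real.sqrt α * deltaK Cs Iop PK α v w * nV φ := by
  set p := PK ((-(Real.sqrt α)⁻¹) • (Cs v.2)) - PK ((-(Real.sqrt α)⁻¹) • (Cs w.2)) with hp
  have hs := Real.sqrt_pos.2 hα
  have hM : 0 ≤ M := (norm_nonneg _).trans hC
  have split : cK Cs Iop PK α v φ - cK Cs Iop PK α w φ =
      -(⟪p, Cs φ.2⟫ + (Real.sqrt α)⁻¹ * ⟪Iop (v.1 - w.1), Iop φ.1⟫) := by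
    simp only [cK, hp, map_sub, inner_sub_left]
    ring
  have h₁ : |⟪p, Cs φ.2⟫| ≤ ‖p‖ * (M * ‖φ.2‖) :=
    (abs_real_inner_le_norm _ _).trans (by gcongr; exact Cs.le_of_opNorm_le hC _)
  have h₂ : |⟪Iop (v.1 - w.1), Iop φ.1⟫| ≤ ‖Iop (v.1 - w.1)‖ * (M * ‖φ.1‖) :=
    (abs_real_inner_le_norm _ _).trans (by gcongr; exact Iop.le_of_opNorm_le hI _)
  have h₃ := mul_add_mul_le_sqrt_mul_sqrt (Real.sqrt α * ‖p‖) ‖Iop (v.1 - w.1)‖ ‖φ.2‖ ‖φ.1‖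
  rw [add_comm (‖φ.2‖ ^ 2), mul_pow, Real.sq_sqrt hα.le] at h₃
  rw [split, abs_neg]
  calc |⟪p, Cs φ.2⟫ + (Real.sqrt α)⁻¹ * ⟪Iop (v.1 - w.1), Iop φ.1⟫|
      ≤ |⟪p, Cs φ.2⟫| + (Real.sqrt α)⁻¹ * |⟪Iop (v.1 - w.1), Iop φ.1⟫| := by
        refine (abs_add_le _ _).trans_eq ?_
        rw [abs_mul, abs_of_pos (inv_pos.2 hs)]
    _ ≤ ‖p‖ * (M * ‖φ.2‖) + (Real.sqrt α)⁻¹ * (‖Iop (v.1 - w.1)‖ * (M * ‖φ.1‖)) := by gcongr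
    _ = M / Real.sqrt α * (Real.sqrt α * ‖p‖ * ‖φ.2‖ + ‖Iop (v.1 - w.1)‖ * ‖φ.1‖) := by
        field_simp
    _ ≤ M / Real.sqrt α * (deltaK Cs Iop PK α v w * nV φ) :=
        mul_le_mul_of_nonneg_left h₃ (by positivity)
    _ = _ := by ring

/-- Testing the difference of `c_{K,α}` with `(-(v₁ - w₁), v₂ - w₂)` controls `δ_{K,α}²`. -/
lemma deltaK_sq_le_cK_sub (Cs : V₂ →L[ℝ] Q) (Iop : V₁ →L[ℝ] W) {K : Set Q} (hK : Convex ℝ K)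
    {PK : Q → Q} (hmem : ∀ q, PK q ∈ K) (hmin : ∀ q, ∀ p ∈ K, ‖q - PK q‖ ≤ ‖q - p‖)
    {α : ℝ} (hα : 0 < α) (v w : V₁ × V₂) :
    (Real.sqrt α)⁻¹ * deltaK Cs Iop PK α v w ^ 2 ≤
      cK Cs Iop PK α v (-(v - w).1, (v - w).2) - cK Cs Iop PK α w (-(v - w).1, (v - w).2) := by
  have hs := Real.sqrt_pos.2 hα
  have hproj := norm_sub_sq_le_inner_of_metricProjection hK hmem hmin
    ((-(Real.sqrt α)⁻¹) • (Cs v.2)) ((-(Real.sqrt α)⁻¹) • (Cs w.2))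
  rw [deltaK, Real.sq_sqrt (by positivity)]
  rw [← smul_sub, real_inner_smul_right] at hproj
  set p := PK ((-(Real.sqrt α)⁻¹) • (Cs v.2)) - PK ((-(Real.sqrt α)⁻¹) • (Cs w.2)) with hp
  have split : cK Cs Iop PK α v (-(v - w).1, (v - w).2) -
      cK Cs Iop PK α w (-(v - w).1, (v - w).2) =
      -⟪p, Cs v.2 - Cs w.2⟫ + (Real.sqrt α)⁻¹ * ‖Iop (v.1 - w.1)‖ ^ 2 := by
    rw [← real_inner_self_eq_norm_sq]
    simp only [cK, hp, map_sub, map_neg, inner_sub_left, inner_sub_right, inner_neg_right,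
      Prod.fst_sub, Prod.snd_sub]
    ring
  have hscaled := mul_le_mul_of_nonneg_left hproj hs.le
  have hα' : (Real.sqrt α)⁻¹ * α = Real.sqrt α := by
    rw [inv_mul_eq_div, Real.div_sqrt]
  have hcancel : Real.sqrt α * (-(Real.sqrt α)⁻¹ * ⟪p, Cs v.2 - Cs w.2⟫) =
      -⟪p, Cs v.2 - Cs w.2⟫ := by
    field_simp
  rw [split, mul_add, ← mul_assoc, hα']
  linarith

lemma cK_add_smul_right (Cs : V₂ →L[ℝ] Q) (Iop : V₁ →L[ℝ] W) (PK : Q → Q) (α r : ℝ)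
    (v φ ψ : V₁ × V₂) :
    cK Cs Iop PK α v (φ + r • ψ) = cK Cs Iop PK α v φ + r * cK Cs Iop PK α v ψ := by
  simp only [cK, Prod.fst_add, Prod.snd_add, Prod.smul_fst, Prod.smul_snd, map_add, map_smul,
    inner_add_right, real_inner_smul_right]
  ring

/-- Scalar form of the monotonicity estimate, by Young's inequality. -/
lemma monotonicity_scalar_bound {m μ L n δ : ℝ} (hm : 0 < m) (hmμ : m ≤ μ) (hL : 0 ≤ L)
    (hn : 0 ≤ n) (hδ : 0 ≤ δ) :
    (1 + L) / (1 + 2 * L) * (m / μ) * ((μ * n + L * δ) * n) ≤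
      m * n ^ 2 + L / m * (1 + 2 * L) * δ ^ 2 - L * δ * n := by
  have hμ := hm.trans_le hmμ
  have hρ : (1 + L) / (1 + 2 * L) ≤ 1 := (div_le_one (by positivity)).2 (by linarith)
  have hq : m / μ ≤ 1 := (div_le_one hμ).2 hmμ
  have hprod : (1 + L) / (1 + 2 * L) * (m / μ) ≤ 1 := mul_le_one₀ hρ (by positivity) hq
  have hcross := mul_le_mul_of_nonneg_right hprod (show 0 ≤ L * δ * n by positivity)
  have hyoung : 0 ≤ L / (m * (1 + 2 * L)) * (m * n - (1 + 2 * L) * δ) ^ 2 := by positivity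
  have hexpand : L / (m * (1 + 2 * L)) * (m * n - (1 + 2 * L) * δ) ^ 2 =
      m * n ^ 2 - (1 + L) / (1 + 2 * L) * m * n ^ 2 + L / m * (1 + 2 * L) * δ ^ 2
        - 2 * (L * δ * n) := by
    field_simp
    ring
  have hsplit : (1 + L) / (1 + 2 * L) * (m / μ) * ((μ * n + L * δ) * n) =
      (1 + L) / (1 + 2 * L) * m * n ^ 2 + (1 + L) / (1 + 2 * L) * (m / μ) * (L * δ * n) := by
    field_simp
  linarith

end Helpers

/-- Theorem 5.1, properties of the form `b_K`: strong monotonicity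
along `T_K` and Lipschitz continuity with respect to the metric `d_{K,α}`. -/
theorem stmt13
    {V₁ V₂ Q W : Type*}
    [NormedAddCommGroup V₁] [InnerProductSpace ℝ V₁] [CompleteSpace V₁] [Nontrivial V₁]
    [NormedAddCommGroup V₂] [InnerProductSpace ℝ V₂] [CompleteSpace V₂] [Nontrivial V₂]
    [NormedAddCommGroup Q] [InnerProductSpace ℝ Q] [CompleteSpace Q]
    [NormedAddCommGroup W] [InnerProductSpace ℝ W] [CompleteSpace W]
    (a : V₁ →L[ℝ] V₂ →L[ℝ] ℝ) (Cs : V₂ →L[ℝ] Q) (Iop : V₁ →L[ℝ] W)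
    (α M_a m_a M_C M_I M L γ κ : ℝ) (hα : 0 < α)
    (hMa : M_a = contConst a)
    (hma : m_a = infSupConst a) (hma_pos : 0 < m_a)
    (hnd : ∀ v₁ : V₁, (∀ v₂ : V₂, a v₁ v₂ = 0) → v₁ = 0)
    (hMC : M_C = ‖Cs‖) (hMI : M_I = ‖Iop‖) (hM : M = max M_I M_C)
    (hL : L = M / Real.sqrt α)
    (hγ : γ = (M / m_a) * (1 + 2 * M / Real.sqrt α))
    (hκ : κ = ((1 + 2 * L) / (1 + L)) * (1 + γ))
    -- the admissible set and its metric projection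
    (K : Set Q) (hK_ne : K.Nonempty) (hK_cl : IsClosed K) (hK_cx : Convex ℝ K)
    (PK : Q → Q) (hPK_mem : ∀ q, PK q ∈ K)
    (hPK : ∀ q : Q, ∀ p ∈ K, ‖q - PK q‖ ≤ ‖q - p‖)
    -- the operator `T_K ψ = m_a (A⁻¹ J₂ ψ₂, A⁻* J₁ ψ₁) + γ (−ψ₁, ψ₂)`
    (TK : V₁ × V₂ → V₁ × V₂)
    (hTK : ∀ ψ : V₁ × V₂, ∃ w₁ : V₁, ∃ w₂ : V₂,
      (∀ φ₂ : V₂, a w₁ φ₂ = ⟪ψ.2, φ₂⟫) ∧ (∀ φ₁ : V₁, a φ₁ w₂ = ⟪ψ.1, φ₁⟫) ∧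
      TK ψ = (m_a • w₁ - γ • ψ.1, m_a • w₂ + γ • ψ.2)) :
    (∀ v w : V₁ × V₂,
      ((1 + L) / (1 + 2 * L)) * (m_a / M_a) *
          ((M_a * nV (v - w) + (M / Real.sqrt α) * deltaK Cs Iop PK α v w) * nV (v - w)) ≤
        bK a Cs Iop PK α v (TK (v - w)) - bK a Cs Iop PK α w (TK (v - w)) ∧
      (1 / κ) * (m_a / M_a) *
          ((M_a * nV (v - w) + (M / Real.sqrt α) * deltaK Cs Iop PK α v w) *
            nV (TK (v - w))) ≤
        ((1 + L) / (1 + 2 * L)) * (m_a / M_a) *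
          ((M_a * nV (v - w) + (M / Real.sqrt α) * deltaK Cs Iop PK α v w) * nV (v - w))) ∧
    (∀ v w φ : V₁ × V₂,
      |bK a Cs Iop PK α v φ - bK a Cs Iop PK α w φ| ≤
        (M_a * nV (v - w) + (M / Real.sqrt α) * deltaK Cs Iop PK α v w) * nV φ) := by
  have hs := Real.sqrt_pos.2 hα
  have hC : ‖Cs‖ ≤ M := by rw [hM, ← hMC]; exact le_max_right _ _
  have hI : ‖Iop‖ ≤ M := by rw [hM, ← hMI]; exact le_max_left _ _
  have hM0 : 0 ≤ M := (norm_nonneg _).trans hC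
  have hL0 : 0 ≤ L := by rw [hL]; positivity
  have hle : m_a ≤ M_a := by rw [hma, hMa]; exact infSupConst_le_contConst a
  have hMa_pos := hma_pos.trans_le hle
  have hγL : γ = M / m_a * (1 + 2 * L) := by rw [hγ, hL]; ring
  have hγ0 : 0 ≤ γ := by rw [hγL]; positivity
  have stable (y : V₂) (f : V₁) (h : ∀ x, a x y = ⟪f, x⟫) : m_a * ‖y‖ ≤ ‖f‖ := by
    rw [hma]
    exact infSupConst_mul_norm_le a (norm_nonneg f) fun x => by
      rw [h]; exact real_inner_le_norm f x
  have stable' (x : V₁) (g : V₂) (h : ∀ y, a x y = ⟪g, y⟫) : m_a * ‖x‖ ≤ ‖g‖ := by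
    rcases eq_or_ne x 0 with rfl | hx
    · simp
    obtain ⟨-, z, -, hz, -⟩ := hTK (x, 0)
    have hzn := stable z x hz
    have hxx : ‖x‖ ^ 2 ≤ ‖g‖ * ‖z‖ := by
      rw [← real_inner_self_eq_norm_sq, ← hz x, h]
      exact real_inner_le_norm g z
    refine le_of_mul_le_mul_right ?_ (norm_pos_iff.2 hx)
    nlinarith [mul_le_mul_of_nonneg_left hzn (norm_nonneg g),
      mul_le_mul_of_nonneg_left hxx hma_pos.le]
  have hδ0 (v w : V₁ × V₂) : 0 ≤ deltaK Cs Iop PK α v w := Real.sqrt_nonneg _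
  refine ⟨fun v w => ?_, fun v w φ => ?_⟩
  · obtain ⟨w₁, w₂, hw₁, hw₂, hT⟩ := hTK (v - w)
    have hw₁n := stable' w₁ _ hw₁
    have hw₂n := stable w₂ _ hw₂
    have hω : nV ((m_a • w₁, m_a • w₂) : V₁ × V₂) ≤ nV (v - w) := by
      refine Real.sqrt_le_sqrt ?_
      simp only [norm_smul, Real.norm_of_nonneg hma_pos.le]
      rw [add_comm (‖(v - w).1‖ ^ 2)]
      gcongr
    have hT' : TK (v - w) =
        (m_a • w₁, m_a • w₂) + γ • ((-(v - w).1, (v - w).2) : V₁ × V₂) := by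
      rw [hT]
      ext <;> simp [sub_eq_add_neg]
    have hTn : nV (TK (v - w)) ≤ (1 + γ) * nV (v - w) := by
      have h₁ : ‖(TK (v - w)).1‖ ≤ ‖(v - w).2‖ + γ * ‖(v - w).1‖ := by
        rw [hT]
        refine (norm_sub_le _ _).trans ?_
        rw [norm_smul, norm_smul, Real.norm_of_nonneg hma_pos.le, Real.norm_of_nonneg hγ0]
        gcongr
      have h₂ : ‖(TK (v - w)).2‖ ≤ ‖(v - w).1‖ + γ * ‖(v - w).2‖ := by
        rw [hT]
        refine (norm_add_le _ _).trans ?_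
        rw [norm_smul, norm_smul, Real.norm_of_nonneg hma_pos.le, Real.norm_of_nonneg hγ0]
        gcongr
      refine Real.sqrt_le_iff.2 ⟨mul_nonneg (by positivity) (nV_nonneg _), ?_⟩
      rw [mul_pow, nV_sq]
      calc _ ≤ (‖(v - w).2‖ + γ * ‖(v - w).1‖) ^ 2 + (‖(v - w).1‖ + γ * ‖(v - w).2‖) ^ 2 := by
            gcongr
        _ ≤ _ := by nlinarith [mul_nonneg hγ0 (sq_nonneg (‖(v - w).1‖ - ‖(v - w).2‖))]
    have hn := nV_nonneg (v - w)
    have hδ := hδ0 v w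
    constructor
    · have ha : aV a (v - w) (TK (v - w)) = m_a * nV (v - w) ^ 2 := by
        rw [hT, nV_sq, ← real_inner_self_eq_norm_sq, ← real_inner_self_eq_norm_sq]
        simp only [aV, map_add, map_sub, map_smul, sub_apply,
          smul_apply, smul_eq_mul, hw₁, hw₂]
        ring
      have hc := neg_le_of_abs_le (abs_cK_sub_le Cs Iop PK hα hC hI v w (m_a • w₁, m_a • w₂))
      have hc' := mul_le_mul_of_nonneg_left
        (deltaK_sq_le_cK_sub Cs Iop hK_cx hPK_mem hPK hα v w) hγ0
      have hγs : γ * ((Real.sqrt α)⁻¹ * deltaK Cs Iop PK α v w ^ 2) =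
          L / m_a * (1 + 2 * L) * deltaK Cs Iop PK α v w ^ 2 := by
        rw [hγL, hL]; ring
      rw [aV_sub_left] at ha
      rw [← hL] at hc ⊢
      have hωδ := mul_le_mul_of_nonneg_left hω (mul_nonneg hL0 hδ)
      refine (monotonicity_scalar_bound hma_pos hle hL0 hn hδ).trans ?_
      have hcv := cK_add_smul_right Cs Iop PK α γ v (m_a • w₁, m_a • w₂)
        (-(v - w).1, (v - w).2)
      have hcw := cK_add_smul_right Cs Iop PK α γ w (m_a • w₁, m_a • w₂)
        (-(v - w).1, (v - w).2)
      rw [← hT'] at hcv hcw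
      simp only [bK]
      linarith
    · have hκ' : (1 + L) / (1 + 2 * L) = 1 / κ * (1 + γ) := by
        rw [hκ]; field_simp
      have hκ0 : 0 ≤ κ := by rw [hκ]; positivity
      have hd : 0 ≤ M_a * nV (v - w) + M / Real.sqrt α * deltaK Cs Iop PK α v w := by
        positivity
      rw [hκ']
      calc _ ≤ 1 / κ * (m_a / M_a) *
            ((M_a * nV (v - w) + M / Real.sqrt α * deltaK Cs Iop PK α v w) *
              ((1 + γ) * nV (v - w))) := by gcongr
        _ = _ := by ring
  · have h₁ := abs_aV_le a (hMa ▸ hMa_pos.le) (v - w) φ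
    rw [aV_sub_left, ← hMa] at h₁
    have h₂ := abs_cK_sub_le Cs Iop PK hα hC hI v w φ
    calc |bK a Cs Iop PK α v φ - bK a Cs Iop PK α w φ|
        = |(aV a v φ - aV a w φ) + (cK Cs Iop PK α v φ - cK Cs Iop PK α w φ)| := by
          simp only [bK]; ring_nf
      _ ≤ _ := abs_add_le _ _
      _ ≤ _ := by linarith
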